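/- Let Y be a Banach space for which there exist constants C₁, C₂ > 0 and p ≥ 1 such that for every n ∈ ℕ there are y₁,…,y_n ∈ Y with ‖y_j‖ ≥ C₁ for every j and ‖∑_{j=1}^n a_j y_j‖ ≤ C₂ (∑_{j=1}^n |a_j|^p)^{1/p} for all scalars a₁,…,a_n. Let X₁,…,X_m be Banach spaces such that X_k has a normalized unconditional Schauder basis (x_n^{(k)}) for each k = 1,…,m, let n₁,…,n_m ≥ 1, and let 0 < q < p. If every continuous (n₁,…,n_m)-homogeneous polynomial from X₁ × ⋯ × X_m into Y is absolutely (q;1)-summing, then for every t > q and all x_k = ∑_j a_j^{(k)} x_j^{(k)} ∈ X_k (k = 1,…,m) one has ∑_j (∏_{k=1}^m |a_j^{(k)}|^{n_k})^t < ∞. -/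

import Mathlib

open scoped BigOperators

/-- A sequence in a normed space is *weakly 1-summable*. -/
def WeaklySummable (𝕂 : Type*) [RCLike 𝕂] {X : Type*} [NormedAddCommGroup X]
    [NormedSpace 𝕂 X] (x : ℕ → X) : Prop :=
  ∀ φ : X →L[𝕂] 𝕂, Summable fun j => ‖φ (x j)‖

/-- `P` is a continuous `(n 0, …, n (m-1))`-homogeneous polynomial, i.e. it comes from a
continuous multilinear map in `n 0 + ⋯ + n (m-1)` variables (`n k` copies of `X k`). -/
def IsMultiPoly (𝕂 : Type*) [RCLike 𝕂] {m : ℕ} (n : Fin m → ℕ)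
    {X : Fin m → Type*} [∀ k, NormedAddCommGroup (X k)] [∀ k, NormedSpace 𝕂 (X k)]
    {Y : Type*} [NormedAddCommGroup Y] [NormedSpace 𝕂 Y]
    (P : (∀ k, X k) → Y) : Prop :=
  ∃ T : ContinuousMultilinearMap 𝕂 (fun i : Σ k : Fin m, Fin (n k) => X i.1) Y,
    ∀ x : ∀ k, X k, P x = T fun i => x i.1

/-- `e` is a normalized unconditional Schauder basis of `X`. -/
def IsNormalizedUncondBasis (𝕂 : Type*) [RCLike 𝕂] (X : Type*) [NormedAddCommGroup X]
    [NormedSpace 𝕂 X] (e : ℕ → X) : Prop :=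
  (∀ n, ‖e n‖ = 1) ∧
  (∀ x : X, ∃! a : ℕ → 𝕂, HasSum (fun n => a n • e n) x) ∧
  ∃ ρ : ℝ, 1 ≤ ρ ∧ ∀ (a ε : ℕ → 𝕂) (x y : X),
    (∀ n, ε n = 1 ∨ ε n = -1) →
    HasSum (fun n => a n • e n) x → HasSum (fun n => (ε n * a n) • e n) y →
    ‖y‖ ≤ ρ * ‖x‖

section Coefficients

variable {𝕂 : Type*} [RCLike 𝕂]

/-- A normalized unconditional basis has uniformly bounded biorthogonal functionals. -/
theorem IsNormalizedUncondBasis.exists_coord {X : Type*} [NormedAddCommGroup X]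
    [NormedSpace 𝕂 X] {e : ℕ → X} (he : IsNormalizedUncondBasis 𝕂 X e) :
    ∃ (c : ℕ → X →L[𝕂] 𝕂) (R : ℝ), 0 < R ∧ (∀ j x, ‖c j x‖ ≤ R * ‖x‖) ∧
      (∀ x, HasSum (fun j => c j x • e j) x) ∧ ∀ i j, c i (e j) = if i = j then 1 else 0 := by
  obtain ⟨hnorm, hex, ρ, hρ, hsign⟩ := he
  choose a ha huniq using hex
  have hbound : ∀ j x, ‖a x j‖ ≤ (1 + ρ) * ‖x‖ := by
    intro j x
    have hy : HasSum (fun n => ((if n = j then -1 else 1 : 𝕂) * a x n) • e n)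
        (x + -((2 : 𝕂) • (a x j • e j))) := by
      refine ((ha x).add (hasSum_ite_eq j (-((2 : 𝕂) • (a x j • e j))))).congr_fun ?_
      intro n
      by_cases h : n = j
      · subst h
        simp only [if_true]
        module
      · simp [h]
    have h1 := hsign (a x) _ x _ (fun n => by by_cases h : n = j <;> simp [h]) (ha x) hy
    have h2 : ‖(2 : 𝕂) • (a x j • e j)‖ = 2 * ‖a x j‖ := by
      simp [norm_smul, hnorm]
    have h3 : ‖(2 : 𝕂) • (a x j • e j)‖ ≤ ‖x‖ + ‖x + -((2 : 𝕂) • (a x j • e j))‖ := by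
      calc ‖(2 : 𝕂) • (a x j • e j)‖
          = ‖x - (x + -((2 : 𝕂) • (a x j • e j)))‖ := by congr 1; abel
        _ ≤ _ := norm_sub_le _ _
    nlinarith [norm_nonneg (a x j)]
  let c : ℕ → X →L[𝕂] 𝕂 := fun j => LinearMap.mkContinuous
    { toFun := fun x => a x j
      map_add' := fun x y => by
        have h := huniq (x + y) (fun n => a x n + a y n)
          (by simpa only [add_smul] using (ha x).add (ha y))
        exact (congrFun h j).symm
      map_smul' := fun r x => by
        have h := huniq (r • x) (fun n => r * a x n)
          (by simpa only [mul_smul] using (ha x).const_smul r)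
        exact (congrFun h j).symm } (1 + ρ) (hbound j)
  refine ⟨c, 1 + ρ, by linarith, hbound, ha, fun i j => ?_⟩
  have h := huniq (e j) (fun n => if n = j then 1 else 0)
    ((hasSum_ite_eq j (e j)).congr_fun fun n => by by_cases h : n = j <;> simp [h])
  exact (congrFun h i).symm

variable {m : ℕ} {X : Fin m → Type*} [∀ k, NormedAddCommGroup (X k)]
  [∀ k, NormedSpace 𝕂 (X k)] {Y : Type*} [NormedAddCommGroup Y] [NormedSpace 𝕂 Y]

/-- The product `∏ k, |cⱼ(u k)| ^ n k` of powers of the `j`-th coordinates. -/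
def coordMonomial (n : Fin m → ℕ) (c : ∀ k, ℕ → X k →L[𝕂] 𝕂) (j : ℕ) (u : ∀ k, X k) : ℝ :=
  ∏ k, ‖c k j (u k)‖ ^ n k

theorem coordMonomial_nonneg (n : Fin m → ℕ) (c : ∀ k, ℕ → X k →L[𝕂] 𝕂) (j : ℕ)
    (u : ∀ k, X k) : 0 ≤ coordMonomial n c j u :=
  Finset.prod_nonneg fun _ _ => by positivity

theorem coordMonomial_smul (n : Fin m → ℕ) (c : ∀ k, ℕ → X k →L[𝕂] 𝕂) (j : ℕ) (s : 𝕂)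
    (u : ∀ k, X k) :
    coordMonomial n c j (s • u) = ‖s‖ ^ (∑ k, n k) * coordMonomial n c j u := by
  simp [coordMonomial, mul_pow, Finset.prod_mul_distrib, Finset.prod_pow_eq_pow_sum]

theorem continuous_coordMonomial (n : Fin m → ℕ) (c : ∀ k, ℕ → X k →L[𝕂] 𝕂) (j : ℕ) :
    Continuous (coordMonomial n c j) := by
  unfold coordMonomial
  fun_prop

theorem coordMonomial_le {n : Fin m → ℕ} {c : ∀ k, ℕ → X k →L[𝕂] 𝕂} {R : Fin m → ℝ}
    (hR : ∀ k j x, ‖c k j x‖ ≤ R k * ‖x‖) (hR0 : ∀ k, 0 < R k) (j : ℕ) {u : ∀ k, X k}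
    (hu : ∀ k, ‖u k‖ ≤ 1) : coordMonomial n c j u ≤ ∏ k, R k ^ n k := by
  refine Finset.prod_le_prod (fun _ _ => by positivity) fun k _ => ?_
  gcongr
  exact (hR k j (u k)).trans (mul_le_of_le_one_right (hR0 k).le (hu k))

theorem norm_apply_smul_eq {n : Fin m → ℕ}
    (T : ContinuousMultilinearMap 𝕂 (fun i : Σ k : Fin m, Fin (n k) => X i.1) Y)
    (e : ∀ k, ℕ → X k) (c : ∀ k, ℕ → X k →L[𝕂] 𝕂) (j : ℕ) (u : ∀ k, X k) :
    ‖T fun i => c i.1 j (u i.1) • e i.1 j‖ =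
      ‖T fun i => e i.1 j‖ * coordMonomial n c j u := by
  rw [T.map_smul_univ (fun i => c i.1 j (u i.1)) (fun i => e i.1 j), norm_smul, mul_comm, norm_prod, Fintype.prod_sigma]
  exact congrArg _ (Finset.prod_congr rfl fun k _ => Fin.prod_const (n k) ‖c k j (u k)‖)

theorem norm_le_two_mul_or {E : Type*} [SeminormedAddCommGroup E] (g h : E) :
    ∃ b : Bool, ‖g‖ ≤ 2 * ‖h + if b then g else 0‖ := by
  by_cases hb : ‖g‖ ≤ 2 * ‖h‖
  · exact ⟨false, by simpa using hb⟩
  · refine ⟨true, ?_⟩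
    have := norm_sub_le (h + g) h
    rw [add_sub_cancel_left] at this
    simp only [if_true]
    linarith

/-- Pointwise finiteness of the `q`-sums implies a uniform bound, by Baire's theorem. -/
theorem exists_uniform_bound [∀ k, CompleteSpace (X k)] [CompleteSpace Y] {n : Fin m → ℕ}
    {e : ∀ k, ℕ → X k} {c : ∀ k, ℕ → X k →L[𝕂] 𝕂} {q : ℝ} (hq : 0 < q)
    (hfin : ∀ (T : ContinuousMultilinearMap 𝕂 (fun i : Σ k : Fin m, Fin (n k) => X i.1) Y)
      (u : ∀ k, X k), Summable fun j => (‖T fun i => e i.1 j‖ * coordMonomial n c j u) ^ q) :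
    ∃ K : ℝ, 0 ≤ K ∧
      ∀ (T : ContinuousMultilinearMap 𝕂 (fun i : Σ k : Fin m, Fin (n k) => X i.1) Y)
        (u : ∀ k, X k), (∀ k, ‖u k‖ ≤ 1) → ∀ N,
        ∑ j ∈ Finset.range N, (‖T fun i => e i.1 j‖ * coordMonomial n c j u) ^ q
          ≤ K * ‖T‖ ^ q := by
  let M := ContinuousMultilinearMap 𝕂 (fun i : Σ k : Fin m, Fin (n k) => X i.1) Y
  let f : ℕ → M → (∀ k, X k) → ℝ :=
    fun j T u => (‖T fun i => e i.1 j‖ * coordMonomial n c j u) ^ q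
  have hf0 : ∀ j T u, 0 ≤ f j T u := fun j T u =>
    Real.rpow_nonneg (mul_nonneg (norm_nonneg _) (coordMonomial_nonneg _ _ _ _)) _
  have hfcont : ∀ j, Continuous fun z : M × (∀ k, X k) => f j z.1 z.2 := by
    intro j
    refine Continuous.rpow_const (Continuous.mul ?_ ?_) fun _ => Or.inr hq.le
    · exact ((continuous_eval_const (F := M)
        fun i : Σ k : Fin m, Fin (n k) => e i.1 j).comp continuous_fst).norm
    · exact (continuous_coordMonomial n c j).comp continuous_snd
  let A : ℕ → Set (M × (∀ k, X k)) :=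
    fun L => {z | ∀ N, ∑ j ∈ Finset.range N, f j z.1 z.2 ≤ L}
  have hA : ∀ L, IsClosed (A L) := by
    intro L
    have : A L = ⋂ N, {z | ∑ j ∈ Finset.range N, f j z.1 z.2 ≤ L} := by
      ext z; simp [A]
    rw [this]
    exact isClosed_iInter fun N =>
      isClosed_le (continuous_finsetSum _ fun j _ => hfcont j) continuous_const
  have hU : ⋃ L, A L = Set.univ := by
    refine Set.eq_univ_of_forall fun z => ?_
    obtain ⟨L, hL⟩ := exists_nat_ge (∑' j, f j z.1 z.2)
    exact Set.mem_iUnion.2 ⟨L, fun N =>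
      ((hfin z.1 z.2).sum_le_tsum _ fun j _ => hf0 j _ _).trans hL⟩
  obtain ⟨L, ⟨T₀, x₀⟩, hz⟩ := nonempty_interior_of_iUnion_of_closed hA hU
  obtain ⟨ε, hε, hball⟩ := Metric.mem_nhds_iff.1 (mem_interior_iff_mem_nhds.1 hz)
  have hmem : ∀ (T : M) (u : ∀ k, X k), ‖T‖ < ε → (∀ k, ‖u k‖ < ε) →
      ∀ N, ∑ j ∈ Finset.range N, f j (T₀ + T) (x₀ + u) ≤ L := by
    intro T u hT hu
    refine hball (a := (T₀ + T, x₀ + u)) ?_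
    rw [Metric.mem_ball, Prod.dist_eq, max_lt_iff]
    refine ⟨by simpa [dist_eq_norm] using hT, ?_⟩
    simpa [dist_eq_norm] using (pi_norm_lt_iff hε).2 hu
  let D : ℝ := (2 * 2 ^ ∑ k, n k) ^ q
  have hD : 0 ≤ D := by positivity
  let B : ℝ := D * (Fintype.card (Bool × (Fin m → Bool)) * L)
  have hB : 0 ≤ B := by positivity
  have hsmall : ∀ (T : M) (u : ∀ k, X k), ‖T‖ < ε → (∀ k, ‖u k‖ < ε) →
      ∀ N, ∑ j ∈ Finset.range N, f j T u ≤ B := by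
    intro T u hT hu N
    let g : Bool × (Fin m → Bool) → ℕ → ℝ := fun b j =>
      f j (T₀ + if b.1 then T else 0) (x₀ + fun k => if b.2 k then u k else 0)
    have hpt : ∀ j, f j T u ≤ D * ∑ b, g b j := by
      intro j
      obtain ⟨b, hb⟩ := norm_le_two_mul_or (T fun i => e i.1 j) (T₀ fun i => e i.1 j)
      choose s hs using fun k => norm_le_two_mul_or (c k j (u k)) (c k j (x₀ k))
      have h1 : f j T u ≤ D * g (b, s) j := by
        simp only [f, D, g]
        rw [← Real.mul_rpow (by positivity)
          (mul_nonneg (norm_nonneg _) (coordMonomial_nonneg _ _ _ _))]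
        refine Real.rpow_le_rpow
          (mul_nonneg (norm_nonneg _) (coordMonomial_nonneg _ _ _ _)) ?_ hq.le
        rw [mul_mul_mul_comm]
        refine mul_le_mul ?_ ?_ (coordMonomial_nonneg _ _ _ _) (by positivity)
        · refine hb.trans_eq ?_
          cases b <;> simp
        · rw [coordMonomial, coordMonomial, ← Finset.prod_pow_eq_pow_sum,
            ← Finset.prod_mul_distrib]
          refine Finset.prod_le_prod (fun _ _ => by positivity) fun k _ => ?_
          rw [← mul_pow]
          refine pow_le_pow_left₀ (norm_nonneg _) ((hs k).trans_eq ?_) _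
          cases h : s k <;> simp [h]
      refine h1.trans (mul_le_mul_of_nonneg_left ?_ hD)
      exact Finset.single_le_sum (f := fun b => g b j) (fun b _ => hf0 _ _ _)
        (Finset.mem_univ (b, s))
    calc ∑ j ∈ Finset.range N, f j T u
        ≤ ∑ j ∈ Finset.range N, D * ∑ b, g b j := Finset.sum_le_sum fun j _ => hpt j
      _ = D * ∑ b, ∑ j ∈ Finset.range N, g b j := by
          rw [← Finset.mul_sum, Finset.sum_comm]
      _ ≤ D * ∑ _b : Bool × (Fin m → Bool), (L : ℝ) := by
          refine mul_le_mul_of_nonneg_left (Finset.sum_le_sum fun b _ => ?_) hD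
          refine hmem _ _ ?_ (fun k => ?_) N
          · cases b.1 <;> simp [hT, hε]
          · cases h : b.2 k <;> simp [hu, hε]
      _ = B := by simp [B]
  let δ : ℝ := ε / 2
  have hδ : 0 < δ := by positivity
  let s : ℝ := (δ * δ ^ ∑ k, n k) ^ q
  have hs : 0 < s := by positivity
  refine ⟨B / s, by positivity, fun T u hu N => ?_⟩
  rcases eq_or_ne T 0 with rfl | hT
  · simp [Real.zero_rpow hq.ne']
  have hT0 : 0 < ‖T‖ := norm_pos_iff.2 hT
  have h1 := hsmall (((δ / ‖T‖ : ℝ) : 𝕂) • T) ((δ : 𝕂) • u)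
    (by
      rw [norm_smul, RCLike.norm_ofReal, abs_of_pos (by positivity),
        div_mul_cancel₀ _ hT0.ne']
      exact half_lt_self hε)
    (fun k => by
      rw [Pi.smul_apply, norm_smul, RCLike.norm_ofReal, abs_of_pos hδ]
      exact (mul_le_of_le_one_right hδ.le (hu k)).trans_lt (half_lt_self hε)) N
  have h2 : ∀ j, f j (((δ / ‖T‖ : ℝ) : 𝕂) • T) ((δ : 𝕂) • u) = s / ‖T‖ ^ q * f j T u := by
    intro j
    have h0 := coordMonomial_nonneg n c j u
    simp only [f, s, smul_apply, coordMonomial_smul, norm_smul,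
      RCLike.norm_ofReal, abs_of_pos hδ, abs_of_pos (div_pos hδ hT0)]
    rw [← Real.div_rpow (by positivity) (by positivity),
      ← Real.mul_rpow (by positivity) (by positivity)]
    congr 1
    ring
  simp only [h2, ← Finset.mul_sum] at h1
  have hTq : 0 < ‖T‖ ^ q := by positivity
  rw [div_mul_eq_mul_div, div_le_iff₀ (by positivity)] at h1
  rw [div_mul_eq_mul_div, le_div_iff₀ hs, mul_comm]
  exact h1

/-- A mixed product of coordinates is controlled by the unmixed ones. -/
theorem rpow_prod_coord_le_sum {n : Fin m → ℕ} (hn : ∀ k, 1 ≤ n k)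
    (c : ∀ k, ℕ → X k →L[𝕂] 𝕂) (j : ℕ) (v : ∀ i : Σ k : Fin m, Fin (n k), X i.1)
    {p : ℝ} (hp : 0 ≤ p) :
    (∏ i, ‖c i.1 j (v i)‖) ^ p ≤
      ∑ s : ∀ k, Fin (n k), coordMonomial n c j (fun k => v ⟨k, s k⟩) ^ p := by
  have hmax : ∀ k, ∃ l : Fin (n k), ∀ l', ‖c k j (v ⟨k, l'⟩)‖ ≤ ‖c k j (v ⟨k, l⟩)‖ := by
    intro k
    have : Nonempty (Fin (n k)) := ⟨⟨0, hn k⟩⟩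
    exact Finite.exists_max fun l => ‖c k j (v ⟨k, l⟩)‖
  choose s hs using hmax
  have h1 : ∏ i, ‖c i.1 j (v i)‖ ≤ coordMonomial n c j (fun k => v ⟨k, s k⟩) := by
    rw [Fintype.prod_sigma, coordMonomial]
    refine Finset.prod_le_prod (fun _ _ => Finset.prod_nonneg fun _ _ => norm_nonneg _)
      fun k _ => ?_
    refine (Finset.prod_le_prod (fun _ _ => norm_nonneg _) fun l _ => hs k l).trans_eq ?_
    simp
  refine (Real.rpow_le_rpow (Finset.prod_nonneg fun _ _ => norm_nonneg _) h1 hp).trans ?_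
  exact Finset.single_le_sum
    (f := fun s : ∀ k, Fin (n k) => coordMonomial n c j (fun k => v ⟨k, s k⟩) ^ p)
    (fun _ _ => Real.rpow_nonneg (coordMonomial_nonneg _ _ _ _) _) (Finset.mem_univ s)

/-- A multilinear map is bounded by its values on the unit balls. -/
theorem opNorm_le_of_unit_balls {ι : Type*} [Fintype ι] {E : ι → Type*}
    [∀ i, NormedAddCommGroup (E i)] [∀ i, NormedSpace 𝕂 (E i)]
    (T : ContinuousMultilinearMap 𝕂 E Y) {H : ℝ} (hH : 0 ≤ H)
    (h : ∀ v, (∀ i, ‖v i‖ ≤ 1) → ‖T v‖ ≤ H) : ‖T‖ ≤ H := by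
  refine T.opNorm_le_bound hH fun v => ?_
  have hv : v = fun i => (‖v i‖ : 𝕂) • ((‖v i‖⁻¹ : ℝ) : 𝕂) • v i := by
    funext i
    rcases eq_or_ne (v i) 0 with h0 | h0
    · simp [h0]
    · rw [smul_smul, ← RCLike.ofReal_mul, mul_inv_cancel₀ (norm_ne_zero_iff.2 h0)]
      simp
  conv_lhs => rw [hv]
  rw [T.map_smul_univ, norm_smul, mul_comm]
  simp only [norm_prod, RCLike.norm_ofReal, abs_norm]
  refine mul_le_mul_of_nonneg_right (h _ fun i => ?_)
    (Finset.prod_nonneg fun _ _ => norm_nonneg _)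
  rw [norm_smul, RCLike.norm_ofReal, abs_of_nonneg (by positivity)]
  exact inv_mul_le_one

/-- The diagonal multilinear map `v ↦ ∑ j < N, (∏ i, cⱼ(v i)) • y j`. -/
noncomputable def diagonalMap (n : Fin m → ℕ) (c : ∀ k, ℕ → X k →L[𝕂] 𝕂) {N : ℕ}
    (y : Fin N → Y) :
    ContinuousMultilinearMap 𝕂 (fun i : Σ k : Fin m, Fin (n k) => X i.1) Y :=
  ∑ j : Fin N, ((ContinuousMultilinearMap.mkPiAlgebra 𝕂
    (Σ k : Fin m, Fin (n k)) 𝕂).compContinuousLinearMap fun i => c i.1 j).smulRight (y j)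

theorem diagonalMap_apply (n : Fin m → ℕ) (c : ∀ k, ℕ → X k →L[𝕂] 𝕂) {N : ℕ}
    (y : Fin N → Y) (v : ∀ i : Σ k : Fin m, Fin (n k), X i.1) :
    diagonalMap n c y v = ∑ j : Fin N, (∏ i, c i.1 j (v i)) • y j := by
  simp [diagonalMap]

theorem diagonalMap_basis (hm : 0 < m) {n : Fin m → ℕ} (hn : ∀ k, 1 ≤ n k)
    {c : ∀ k, ℕ → X k →L[𝕂] 𝕂} {e : ∀ k, ℕ → X k}
    (hce : ∀ k i j, c k i (e k j) = if i = j then 1 else 0) {N : ℕ} (y : Fin N → Y)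
    (j : Fin N) : diagonalMap n c y (fun i => e i.1 j) = y j := by
  rw [diagonalMap_apply, Finset.sum_eq_single j]
  · simp [hce]
  · intro i _ hij
    rw [Finset.prod_eq_zero (Finset.mem_univ ⟨⟨0, hm⟩, ⟨0, hn _⟩⟩), zero_smul]
    rw [hce, if_neg (fun h => hij (Fin.ext h))]
  · simp

end Coefficients

theorem rpow_le_rpow_sub_mul_rpow {b Q q t : ℝ} (hb : 0 ≤ b) (hbQ : b ≤ Q) (hq : 0 ≤ q)
    (hqt : q ≤ t) : b ^ t ≤ Q ^ (t - q) * b ^ q := by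
  have h : 0 ≤ t - q := sub_nonneg.2 hqt
  calc b ^ t = b ^ (t - q) * b ^ q := by
        rw [← Real.rpow_add_of_nonneg hb h hq, sub_add_cancel]
    _ ≤ _ := by gcongr

/-- A bounded nonnegative function whose upper bounds improve by `S ↦ L * S ^ θ`, `θ < 1`, is
bounded by a constant depending on `L` and `θ` only. -/
theorem le_of_self_improving {ι : Type*} [Nonempty ι] {s : ι → ℝ} {L θ : ℝ} (hs : ∀ i, 0 ≤ s i)
    (hθ : θ < 1) (hbdd : BddAbove (Set.range s)) (hL : 0 ≤ L)
    (h : ∀ S, 0 ≤ S → (∀ i, s i ≤ S) → ∀ i, s i ≤ L * S ^ θ) (i : ι) :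
    s i ≤ L ^ (1 / (1 - θ)) := by
  set S := ⨆ i, s i with hS
  have hle : ∀ i, s i ≤ S := le_ciSup hbdd
  refine (hle i).trans ?_
  have hS0 : 0 ≤ S := (hs i).trans (hle i)
  rcases hS0.eq_or_lt with h0 | h0
  · rw [← h0]
    positivity
  have h1 : S ≤ L * S ^ θ := ciSup_le (h S hS0 hle)
  have h2 : S ^ (1 - θ) ≤ L := by
    rw [Real.rpow_sub h0, Real.rpow_one, div_le_iff₀ (by positivity)]
    exact h1
  have h3 : 0 < 1 - θ := by linarith
  calc S = (S ^ (1 - θ)) ^ (1 / (1 - θ)) := by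
        rw [← Real.rpow_mul hS0, mul_one_div_cancel h3.ne', Real.rpow_one]
    _ ≤ _ := Real.rpow_le_rpow (by positivity) h2 (by positivity)

/-- Botelho–Pellegrino lemma for multipolynomials: under the stated condition on `Y`, if
`q < p` and every continuous `(n₁,…,n_m)`-homogeneous polynomial into `Y` is absolutely
`(q;1)`-summing, then the products of powers of basis coefficients are `t`-summable for every
`t > q`. -/
theorem stmt12 (𝕂 : Type*) [RCLike 𝕂]
    (Y : Type*) [NormedAddCommGroup Y] [NormedSpace 𝕂 Y] [CompleteSpace Y]
    (C₁ C₂ p : ℝ) (hC₁ : 0 < C₁) (hC₂ : 0 < C₂) (hp : 1 ≤ p)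
    (hY : ∀ N : ℕ, ∃ y : Fin N → Y, (∀ j, C₁ ≤ ‖y j‖) ∧
      ∀ a : Fin N → 𝕂, ‖∑ j, a j • y j‖ ≤ C₂ * (∑ j, ‖a j‖ ^ p) ^ (1 / p))
    (m : ℕ) (hm : 0 < m) (n : Fin m → ℕ) (hn : ∀ k, 1 ≤ n k)
    (X : Fin m → Type*) [∀ k, NormedAddCommGroup (X k)]
    [∀ k, NormedSpace 𝕂 (X k)] [∀ k, CompleteSpace (X k)]
    (e : ∀ k, ℕ → X k) (he : ∀ k, IsNormalizedUncondBasis 𝕂 (X k) (e k))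
    (q : ℝ) (hq : 0 < q) (hqp : q < p)
    (hsum : ∀ P : (∀ k, X k) → Y, IsMultiPoly 𝕂 n P →
      ∀ x : ∀ k, ℕ → X k, (∀ k, WeaklySummable 𝕂 (x k)) →
        Summable fun j => ‖P fun k => x k j‖ ^ q)
    (t : ℝ) (ht : q < t) (x : ∀ k, X k) (a : ∀ _ : Fin m, ℕ → 𝕂)
    (ha : ∀ k, HasSum (fun j => a k j • e k j) (x k)) :
    Summable fun j => (∏ k, ‖a k j‖ ^ (n k : ℝ)) ^ t := by
  have hp0 : 0 < p := by linarith
  choose c R hR0 hR hc hce using fun k => (he k).exists_coord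
  have huniq : ∀ k j, a k j = c k j (x k) := fun k j =>
    congrFun (((he k).2.1 (x k)).unique (ha k) (hc k (x k))) j
  have hweak : ∀ k (u : X k), WeaklySummable 𝕂 fun j => c k j u • e k j := fun k u φ =>
    (φ.hasSum (hc k u)).summable.norm
  obtain ⟨K, hK0, hK⟩ := exists_uniform_bound (e := e) (c := c) (Y := Y) (n := n) hq
    fun T u => by
      have h := hsum (fun z => T fun i => z i.1) ⟨T, fun _ => rfl⟩
        (fun k j => c k j (u k) • e k j) fun k => hweak k (u k)
      simpa only [norm_apply_smul_eq T e c] using h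
  let Q : ℝ := ∏ k, R k ^ n k
  have hQ0 : 0 < Q := Finset.prod_pos fun k _ => pow_pos (hR0 k) _
  have hβQ : ∀ j (u : ∀ k, X k), (∀ k, ‖u k‖ ≤ 1) → coordMonomial n c j u ≤ Q :=
    fun j u hu => coordMonomial_le hR hR0 j hu
  let G : ℝ := Fintype.card (∀ k, Fin (n k))
  let W := {u : ∀ k, X k // ∀ k, ‖u k‖ ≤ 1}
  have : Nonempty W := ⟨⟨0, by simp⟩⟩
  let L : ℝ := K * (C₂ * (G * Q ^ (p - q)) ^ (1 / p)) ^ q / C₁ ^ q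
  have hG0 : 0 ≤ G := Nat.cast_nonneg _
  have hL0 : 0 ≤ L := by positivity
  have hkey : ∀ N (u : W), ∑ j ∈ Finset.range N, coordMonomial n c j u.1 ^ q ≤
      L ^ (1 / (1 - q / p)) := by
    intro N
    refine le_of_self_improving (s := fun u : W =>
      ∑ j ∈ Finset.range N, coordMonomial n c j u.1 ^ q) (fun u => ?_)
      ((div_lt_one hp0).2 hqp) ?_ hL0 ?_
    · exact Finset.sum_nonneg fun j _ => Real.rpow_nonneg (coordMonomial_nonneg _ _ _ _) _
    · refine ⟨∑ j ∈ Finset.range N, Q ^ q, ?_⟩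
      rintro _ ⟨u, rfl⟩
      exact Finset.sum_le_sum fun j _ =>
        Real.rpow_le_rpow (coordMonomial_nonneg _ _ _ _) (hβQ j u.1 u.2) hq.le
    · intro S hS0 hS u
      obtain ⟨y, hy1, hy2⟩ := hY N
      have hSp : ∀ w : W, ∑ j ∈ Finset.range N, coordMonomial n c j w.1 ^ p ≤
          Q ^ (p - q) * S := by
        intro w
        refine le_trans ?_ (mul_le_mul_of_nonneg_left (hS w) (by positivity))
        rw [Finset.mul_sum]
        exact Finset.sum_le_sum fun j _ => rpow_le_rpow_sub_mul_rpow
          (coordMonomial_nonneg _ _ _ _) (hβQ j w.1 w.2) hq.le hqp.le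
      have hT : ‖diagonalMap n c y‖ ≤ C₂ * (G * (Q ^ (p - q) * S)) ^ (1 / p) := by
        refine opNorm_le_of_unit_balls _ (by positivity) fun v hv => ?_
        rw [diagonalMap_apply]
        refine (hy2 _).trans ?_
        gcongr
        simp only [norm_prod]
        calc ∑ j : Fin N, (∏ i, ‖c i.1 j (v i)‖) ^ p
            ≤ ∑ j : Fin N, ∑ s : ∀ k, Fin (n k),
                coordMonomial n c j (fun k => v ⟨k, s k⟩) ^ p :=
              Finset.sum_le_sum fun j _ => rpow_prod_coord_le_sum hn c j v hp0.le
          _ = ∑ s : ∀ k, Fin (n k), ∑ j ∈ Finset.range N,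
                coordMonomial n c j (fun k => v ⟨k, s k⟩) ^ p := by
              rw [Finset.sum_comm]
              exact Finset.sum_congr rfl fun s _ => Fin.sum_univ_eq_sum_range
                (fun j => coordMonomial n c j (fun k => v ⟨k, s k⟩) ^ p) N
          _ ≤ ∑ _s : ∀ k, Fin (n k), Q ^ (p - q) * S :=
              Finset.sum_le_sum fun s _ => hSp ⟨fun k => v ⟨k, s k⟩, fun k => hv _⟩
          _ = _ := by simp [G]
      have hKu := hK (diagonalMap n c y) u.1 u.2 N
      have hlow : C₁ ^ q * ∑ j ∈ Finset.range N, coordMonomial n c j u.1 ^ q ≤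
          ∑ j ∈ Finset.range N, (‖diagonalMap n c y fun i => e i.1 j‖ *
            coordMonomial n c j u.1) ^ q := by
        rw [Finset.mul_sum]
        refine Finset.sum_le_sum fun j hj => ?_
        have h0 := coordMonomial_nonneg n c j u.1
        rw [← Real.mul_rpow hC₁.le h0]
        have h1 := diagonalMap_basis hm hn hce y ⟨j, Finset.mem_range.1 hj⟩
        simp only at h1
        rw [h1]
        gcongr
        exact hy1 _
      have hup : K * ‖diagonalMap n c y‖ ^ q ≤
          K * (C₂ * (G * (Q ^ (p - q) * S)) ^ (1 / p)) ^ q := by gcongr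
      have hfactor : (C₂ * (G * (Q ^ (p - q) * S)) ^ (1 / p)) ^ q =
          (C₂ * (G * Q ^ (p - q)) ^ (1 / p)) ^ q * S ^ (q / p) := by
        rw [← mul_assoc, Real.mul_rpow (by positivity) hS0, ← mul_assoc,
          Real.mul_rpow (by positivity) (by positivity), ← Real.rpow_mul hS0,
          one_div_mul_eq_div]
      have hC : 0 < C₁ ^ q := by positivity
      rw [div_mul_eq_mul_div, le_div_iff₀ hC, mul_comm, mul_assoc, ← hfactor]
      exact hlow.trans (hKu.trans hup)
  let s : ℝ := 1 / (1 + ‖x‖)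
  have hs0 : 0 < s := by positivity
  let w : W := ⟨(s : 𝕂) • x, fun k => by
    rw [Pi.smul_apply, norm_smul, RCLike.norm_ofReal, abs_of_pos hs0,
      div_mul_eq_mul_div, one_mul, div_le_one (by positivity)]
    linarith [norm_le_pi_norm x k]⟩
  have hsummable : Summable fun j => coordMonomial n c j w.1 ^ q :=
    summable_of_sum_range_le
      (fun j => Real.rpow_nonneg (coordMonomial_nonneg _ _ _ _) _) fun N => hkey N w
  have hsummable' : Summable fun j => coordMonomial n c j w.1 ^ t := by
    refine Summable.of_nonneg_of_le
      (fun j => Real.rpow_nonneg (coordMonomial_nonneg _ _ _ _) _) (fun j => ?_)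
      (hsummable.mul_left (Q ^ (t - q)))
    exact rpow_le_rpow_sub_mul_rpow (coordMonomial_nonneg _ _ _ _) (hβQ j w.1 w.2) hq.le ht.le
  have hrescale : ∀ j, (s ^ ∑ k, n k) ^ t * (∏ k, ‖a k j‖ ^ (n k : ℝ)) ^ t =
      coordMonomial n c j w.1 ^ t := by
    intro j
    rw [coordMonomial_smul, RCLike.norm_ofReal, abs_of_pos hs0,
      Real.mul_rpow (by positivity) (coordMonomial_nonneg _ _ _ _)]
    simp only [coordMonomial, huniq, Real.rpow_natCast]
  have hpos : (s ^ ∑ k, n k) ^ t ≠ 0 := (Real.rpow_pos_of_pos (by positivity) _).ne'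
  rw [← summable_mul_left_iff hpos]
  simpa only [hrescale] using hsummable'
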